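/- For all head normal forms t₁ and t₂ of ACP, there exists a head normal form t' of ACP such that the equation t₁ | t₂ = t' (communication merge) is derivable from the axioms of ACP. -/

import Mathlib

namespace ACPNote

/-! ### ACP terms

We fix a set `Act` of actions.  The inaction constant δ is not in `Act`; the set
`Act ∪ {δ}` of constants is represented by `Option Act`, with `none` playing the
role of δ.  The countably infinite set of variables is represented by `ℕ`. -/

/-- Terms over the signature of ACP, with action constants from `Act`,
the inaction constant δ, variables from `ℕ`, alternative composition `alt`,
sequential composition `seq`, parallel composition `par`, left merge `lm`,
communication merge `cm`, and encapsulation operators `encap H` for `H ⊆ Act`. -/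
inductive ACPTerm (Act : Type) : Type
  | act : Act → ACPTerm Act
  | delta : ACPTerm Act
  | var : ℕ → ACPTerm Act
  | alt : ACPTerm Act → ACPTerm Act → ACPTerm Act
  | seq : ACPTerm Act → ACPTerm Act → ACPTerm Act
  | par : ACPTerm Act → ACPTerm Act → ACPTerm Act
  | lm : ACPTerm Act → ACPTerm Act → ACPTerm Act
  | cm : ACPTerm Act → ACPTerm Act → ACPTerm Act
  | encap : Set Act → ACPTerm Act → ACPTerm Act

/-- The ACP constant corresponding to an element of `Act ∪ {δ}`
(`none` is δ, `some a` is the action constant `a`). -/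
def ACPTerm.ofConst {Act : Type} : Option Act → ACPTerm Act
  | none => .delta
  | some a => .act a

/-- Derivability of equations between ACP terms from the axioms of ACP
(A1–A7, CM1–CM9, CF, D1–D4) in equational logic: the axioms are stated as
schemas (i.e. closed under substitution) and derivability is closed under
reflexivity, symmetry, transitivity and congruence for all operators.
The communication function `γ` on `Act ∪ {δ}` interprets the communication
merge on constants (axiom CF). -/
inductive ACPDeriv {Act : Type} (γ : Option Act → Option Act → Option Act) :
    ACPTerm Act → ACPTerm Act → Prop
  | refl (t) : ACPDeriv γ t t
  | symm {t s} : ACPDeriv γ t s → ACPDeriv γ s t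
  | trans {t s u} : ACPDeriv γ t s → ACPDeriv γ s u → ACPDeriv γ t u
  | altCongr {t t' s s'} : ACPDeriv γ t t' → ACPDeriv γ s s' →
      ACPDeriv γ (.alt t s) (.alt t' s')
  | seqCongr {t t' s s'} : ACPDeriv γ t t' → ACPDeriv γ s s' →
      ACPDeriv γ (.seq t s) (.seq t' s')
  | parCongr {t t' s s'} : ACPDeriv γ t t' → ACPDeriv γ s s' →
      ACPDeriv γ (.par t s) (.par t' s')
  | lmCongr {t t' s s'} : ACPDeriv γ t t' → ACPDeriv γ s s' →
      ACPDeriv γ (.lm t s) (.lm t' s')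
  | cmCongr {t t' s s'} : ACPDeriv γ t t' → ACPDeriv γ s s' →
      ACPDeriv γ (.cm t s) (.cm t' s')
  | encapCongr (H : Set Act) {t t'} : ACPDeriv γ t t' →
      ACPDeriv γ (.encap H t) (.encap H t')
  | A1 (x y) : ACPDeriv γ (.alt x y) (.alt y x)
  | A2 (x y z) : ACPDeriv γ (.alt (.alt x y) z) (.alt x (.alt y z))
  | A3 (x) : ACPDeriv γ (.alt x x) x
  | A4 (x y z) : ACPDeriv γ (.seq (.alt x y) z) (.alt (.seq x z) (.seq y z))
  | A5 (x y z) : ACPDeriv γ (.seq (.seq x y) z) (.seq x (.seq y z))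
  | A6 (x) : ACPDeriv γ (.alt x .delta) x
  | A7 (x) : ACPDeriv γ (.seq .delta x) .delta
  | CM1 (x y) : ACPDeriv γ (.par x y) (.alt (.alt (.lm x y) (.lm y x)) (.cm x y))
  | CM2 (a : Option Act) (x) :
      ACPDeriv γ (.lm (.ofConst a) x) (.seq (.ofConst a) x)
  | CM3 (a : Option Act) (x y) :
      ACPDeriv γ (.lm (.seq (.ofConst a) x) y) (.seq (.ofConst a) (.par x y))
  | CM4 (x y z) : ACPDeriv γ (.lm (.alt x y) z) (.alt (.lm x z) (.lm y z))
  | CM5 (a b : Option Act) (x) :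
      ACPDeriv γ (.cm (.seq (.ofConst a) x) (.ofConst b))
        (.seq (.cm (.ofConst a) (.ofConst b)) x)
  | CM6 (a b : Option Act) (x) :
      ACPDeriv γ (.cm (.ofConst a) (.seq (.ofConst b) x))
        (.seq (.cm (.ofConst a) (.ofConst b)) x)
  | CM7 (a b : Option Act) (x y) :
      ACPDeriv γ (.cm (.seq (.ofConst a) x) (.seq (.ofConst b) y))
        (.seq (.cm (.ofConst a) (.ofConst b)) (.par x y))
  | CM8 (x y z) : ACPDeriv γ (.cm (.alt x y) z) (.alt (.cm x z) (.cm y z))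
  | CM9 (x y z) : ACPDeriv γ (.cm x (.alt y z)) (.alt (.cm x y) (.cm x z))
  | CF (a b : Option Act) :
      ACPDeriv γ (.cm (.ofConst a) (.ofConst b)) (.ofConst (γ a b))
  | D1 (a : Option Act) (H : Set Act) (h : ∀ b, a = some b → b ∉ H) :
      ACPDeriv γ (.encap H (.ofConst a)) (.ofConst a)
  | D2 (a : Act) (H : Set Act) (h : a ∈ H) :
      ACPDeriv γ (.encap H (.act a)) .delta
  | D3 (H : Set Act) (x y) :
      ACPDeriv γ (.encap H (.alt x y)) (.alt (.encap H x) (.encap H y))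
  | D4 (H : Set Act) (x y) :
      ACPDeriv γ (.encap H (.seq x y)) (.seq (.encap H x) (.encap H y))

/-- A term is guarded when every occurrence of a variable in it occurs within a
subterm of the form `a · t'` with `a ∈ Act`. -/
def ACPTerm.Guarded {Act : Type} : ACPTerm Act → Prop
  | .act _ => True
  | .delta => True
  | .var _ => False
  | .alt t s => t.Guarded ∧ s.Guarded
  | .seq t s => (∃ a : Act, t = .act a) ∨ (t.Guarded ∧ s.Guarded)
  | .par t s => t.Guarded ∧ s.Guarded
  | .lm t s => t.Guarded ∧ s.Guarded
  | .cm t s => t.Guarded ∧ s.Guarded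
  | .encap _ t => t.Guarded

/-- Head normal forms of ACP: δ, action constants `a`, terms `a · t`
with `a ∈ Act`, and alternative compositions of head normal forms. -/
inductive ACPTerm.HNF {Act : Type} : ACPTerm Act → Prop
  | delta : HNF .delta
  | act (a : Act) : HNF (.act a)
  | seqAct (a : Act) (t : ACPTerm Act) : HNF (.seq (.act a) t)
  | alt {t t'} : HNF t → HNF t' → HNF (.alt t t')

/-- Linear ACP terms: δ, action constants `a`, terms `a · X` with `a ∈ Act`
and `X` a variable, and alternative compositions of linear terms. -/
inductive ACPTerm.Linear {Act : Type} : ACPTerm Act → Prop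
  | delta : Linear .delta
  | act (a : Act) : Linear (.act a)
  | seqVar (a : Act) (X : ℕ) : Linear (.seq (.act a) (.var X))
  | alt {t t'} : Linear t → Linear t' → Linear (.alt t t')

/-- The generalized sum `Σ_{i<n} tᵢ`: the empty sum is δ, a sum of one summand
is that summand, and `Σ_{i<n+1} tᵢ = (Σ_{i<n} tᵢ) + tₙ`. -/
def bigAlt {Act : Type} : (n : ℕ) → (Fin n → ACPTerm Act) → ACPTerm Act
  | 0, _ => .delta
  | 1, f => f 0
  | n + 2, f => .alt (bigAlt (n + 1) fun i => f i.castSucc) (f (Fin.last (n + 1)))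

/-- The set of variables occurring in an ACP term. -/
def ACPTerm.varsOf {Act : Type} : ACPTerm Act → Set ℕ
  | .act _ => ∅
  | .delta => ∅
  | .var X => {X}
  | .alt t s => t.varsOf ∪ s.varsOf
  | .seq t s => t.varsOf ∪ s.varsOf
  | .par t s => t.varsOf ∪ s.varsOf
  | .lm t s => t.varsOf ∪ s.varsOf
  | .cm t s => t.varsOf ∪ s.varsOf
  | .encap _ t => t.varsOf


section

variable {Act : Type} {γ : Option Act → Option Act → Option Act}

theorem ACPTerm.HNF.ofConst (c : Option Act) : (ACPTerm.ofConst c).HNF :=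
  match c with
  | none => .delta
  | some a => .act a

/-- A term is provably equal to a head normal form. -/
def HasHNF (γ : Option Act → Option Act → Option Act) (t : ACPTerm Act) : Prop :=
  ∃ t' : ACPTerm Act, t'.HNF ∧ ACPDeriv γ t t'

namespace HasHNF

theorem of_deriv {t s : ACPTerm Act} (h : ACPDeriv γ t s) : HasHNF γ s → HasHNF γ t
  | ⟨s', hs', hd⟩ => ⟨s', hs', h.trans hd⟩

theorem alt {t s : ACPTerm Act} : HasHNF γ t → HasHNF γ s → HasHNF γ (.alt t s)
  | ⟨t', ht', hdt⟩, ⟨s', hs', hds⟩ => ⟨.alt t' s', ht'.alt hs', .altCongr hdt hds⟩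

theorem ofConst_seq (c : Option Act) (t : ACPTerm Act) :
    HasHNF γ (.seq (.ofConst c) t) :=
  match c with
  | none => ⟨.delta, .delta, .A7 t⟩
  | some a => ⟨.seq (.act a) t, .seqAct a t, .refl _⟩

theorem cm_ofConst (a b : Option Act) : HasHNF γ (.cm (.ofConst a) (.ofConst b)) :=
  ⟨.ofConst (γ a b), .ofConst _, .CF a b⟩

theorem cm_ofConst_seq (a b : Option Act) (t : ACPTerm Act) :
    HasHNF γ (.seq (.cm (.ofConst a) (.ofConst b)) t) :=
  of_deriv (.seqCongr (.CF a b) (.refl t)) (ofConst_seq _ t)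

theorem cm_ofConst_left (a : Option Act) {t : ACPTerm Act} (ht : t.HNF) :
    HasHNF γ (.cm (.ofConst a) t) := by
  induction ht with
  | delta => exact cm_ofConst a none
  | act b => exact cm_ofConst a (some b)
  | seqAct b t => exact of_deriv (.CM6 a (some b) t) (cm_ofConst_seq a (some b) t)
  | alt _ _ iht ihs => exact of_deriv (.CM9 _ _ _) (iht.alt ihs)

theorem cm_seq_left (a : Option Act) (s : ACPTerm Act) {t : ACPTerm Act} (ht : t.HNF) :
    HasHNF γ (.cm (.seq (.ofConst a) s) t) := by
  induction ht with
  | delta => exact of_deriv (.CM5 a none s) (cm_ofConst_seq a none s)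
  | act b => exact of_deriv (.CM5 a (some b) s) (cm_ofConst_seq a (some b) s)
  | seqAct b t =>
    exact of_deriv (.CM7 a (some b) s t) (cm_ofConst_seq a (some b) (.par s t))
  | alt _ _ iht ihs => exact of_deriv (.CM9 _ _ _) (iht.alt ihs)

theorem cm {t s : ACPTerm Act} (ht : t.HNF) (hs : s.HNF) : HasHNF γ (.cm t s) := by
  induction ht with
  | delta => exact cm_ofConst_left none hs
  | act a => exact cm_ofConst_left (some a) hs
  | seqAct a t => exact cm_seq_left (some a) t hs
  | alt _ _ iht ihs => exact of_deriv (.CM8 _ _ _) (iht.alt ihs)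

end HasHNF

end

/-- For all head normal forms `t₁` and `t₂` of ACP, there exists a head normal
form `t'` of ACP such that `t₁ | t₂ = t'` (communication merge) is derivable
from the axioms of ACP. -/
theorem hnf_commMerge_hasHNF (Act : Type)
    (γ : Option Act → Option Act → Option Act)
    (hcomm : ∀ a b, γ a b = γ b a)
    (hassoc : ∀ a b c, γ (γ a b) c = γ a (γ b c))
    (hdelta : ∀ a, γ none a = none)
    (t₁ t₂ : ACPTerm Act) (h₁ : t₁.HNF) (h₂ : t₂.HNF) :
    ∃ t' : ACPTerm Act, t'.HNF ∧ ACPDeriv γ (.cm t₁ t₂) t' :=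
  HasHNF.cm h₁ h₂

end ACPNote
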